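/- arXiv:1507.00952 — 2 statements merged into one kernel-verified Lean document; each statement's English description precedes it below -/
import Mathlib

section
/- The action of Sp(2g, ℤ) on characteristics preserves parity: e(γ·m) = e(m) for every γ ∈ Sp(2g, ℤ) and every m ∈ (ℤ/2)^g × (ℤ/2)^g. Moreover, the even characteristics form one orbit and the odd characteristics form another: for any two characteristics m, m̃ of the same parity there exists γ ∈ Sp(2g, ℤ) with γ·m = m̃. -/
open scoped BigOperators
open Complex Matrix

noncomputable section

/-- The Siegel upper half-space: complex symmetric `g × g` matrices with
positive definite imaginary part. -/
def IsSiegel {g : ℕ} (τ : Matrix (Fin g) (Fin g) ℂ) : Prop :=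
  τ.IsSymm ∧ Matrix.PosDef (Matrix.of fun i j => (τ i j).im)

/-- The `p`-th term of the Riemann theta series with characteristic `m`. -/
def thetaTerm {g : ℕ} (m : (Fin g → ℤ) × (Fin g → ℤ))
    (τ : Matrix (Fin g) (Fin g) ℂ) (z : Fin g → ℂ) (p : Fin g → ℤ) : ℂ :=
  Complex.exp ((Real.pi : ℂ) * Complex.I *
      (∑ i, ∑ j, ((p i : ℂ) + (m.1 i : ℂ) / 2) * τ i j * ((p j : ℂ) + (m.1 j : ℂ) / 2))
    + 2 * (Real.pi : ℂ) * Complex.I *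
      (∑ i, ((p i : ℂ) + (m.1 i : ℂ) / 2) * (z i + (m.2 i : ℂ) / 2)))

/-- The Riemann theta function with characteristic `m`. -/
def theta {g : ℕ} (m : (Fin g → ℤ) × (Fin g → ℤ))
    (τ : Matrix (Fin g) (Fin g) ℂ) (z : Fin g → ℂ) : ℂ :=
  ∑' p : Fin g → ℤ, thetaTerm m τ z p

/-- The gradient `grad_z θ_m(τ, z)|_{z = 0}`. -/
def thetaGrad {g : ℕ} (m : (Fin g → ℤ) × (Fin g → ℤ))
    (τ : Matrix (Fin g) (Fin g) ℂ) : Fin g → ℂ :=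
  fun j => fderiv ℂ (fun z => theta m τ z) 0 (Pi.single j 1)

/-- The Jacobian determinant `D(n₁, …, n_g)(τ)`. -/
def jacDet {g : ℕ} (n : Fin g → (Fin g → ℤ) × (Fin g → ℤ))
    (τ : Matrix (Fin g) (Fin g) ℂ) : ℂ :=
  ((Real.pi : ℂ) ^ g)⁻¹ * Matrix.det (Matrix.of fun i j => thetaGrad (n i) τ j)

/-- A characteristic mod 2 in genus `g`. -/
abbrev ThetaChar (g : ℕ) := (Fin g → ZMod 2) × (Fin g → ZMod 2)

/-- Lift of a mod-2 characteristic to the integer representative with entries in `{0,1}`. -/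
def charLift {g : ℕ} (m : ThetaChar g) : (Fin g → ℤ) × (Fin g → ℤ) :=
  (fun i => ((m.1 i).val : ℤ), fun i => ((m.2 i).val : ℤ))

/-- `m'·m''` computed on the `{0,1}` representatives. -/
def charDot {g : ℕ} (m : ThetaChar g) : ℕ := ∑ i, (m.1 i).val * (m.2 i).val

/-- The parity `e(m) = (-1)^{m'·m''}` of a characteristic. -/
def charParity {g : ℕ} (m : ThetaChar g) : ℤ := (-1) ^ charDot m

def IsOddChar {g : ℕ} (m : ThetaChar g) : Prop := charParity m = -1

def IsEvenChar {g : ℕ} (m : ThetaChar g) : Prop := charParity m = 1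

/-- A tuple of characteristics is azygetic if
`e(nᵢ)e(nⱼ)e(nₖ)e(nᵢ+nⱼ+nₖ) = -1` for all `i < j < k`. -/
def Azygetic {g k : ℕ} (n : Fin k → ThetaChar g) : Prop :=
  ∀ i j l : Fin k, i < j → j < l →
    charParity (n i) * charParity (n j) * charParity (n l) *
      charParity (n i + n j + n l) = -1

/-- An Aronhold set in genus 3: seven pairwise distinct odd characteristics such
that, together with their sum, they form an azygetic 8-tuple. -/
def IsAronhold (n : Fin 7 → ThetaChar 3) : Prop :=
  Function.Injective n ∧ (∀ i, IsOddChar (n i)) ∧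
    Azygetic (Fin.snoc n (∑ i, n i) : Fin 8 → ThetaChar 3)

/-- The standard symplectic form matrix `J = (0 I; -I 0)` over a ring. -/
def Jmat (g : ℕ) (R : Type*) [Ring R] :
    Matrix (Fin g ⊕ Fin g) (Fin g ⊕ Fin g) R :=
  Matrix.fromBlocks 0 1 (-1) 0

/-- The blocks `(a b; c d)` form a symplectic matrix over `R`. -/
def IsSymplectic {g : ℕ} {R : Type*} [Ring R]
    (a b c d : Matrix (Fin g) (Fin g) R) : Prop :=
  (Matrix.fromBlocks a b c d)ᵀ * Jmat g R * Matrix.fromBlocks a b c d = Jmat g R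

/-- The action of `Sp(2g, ℤ)` on mod-2 characteristics. -/
def charAction {g : ℕ} (a b c d : Matrix (Fin g) (Fin g) ℤ) (m : ThetaChar g) : ThetaChar g :=
  (fun i => (∑ j, ((d i j : ZMod 2)) * m.1 j) - (∑ j, ((c i j : ZMod 2)) * m.2 j)
      + (((c * dᵀ) i i : ℤ) : ZMod 2),
   fun i => -(∑ j, ((b i j : ZMod 2)) * m.1 j) + (∑ j, ((a i j : ZMod 2)) * m.2 j)
      + (((a * bᵀ) i i : ℤ) : ZMod 2))

/-- The Jacobian determinant in genus 3, for three mod-2 odd characteristics. -/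
def D3 (n1 n2 n3 : ThetaChar 3) (τ : Matrix (Fin 3) (Fin 3) ℂ) : ℂ :=
  jacDet ![charLift n1, charLift n2, charLift n3] τ

end

/-- In characteristic two, the off-diagonal terms of a symmetric double sum cancel. -/
theorem sum_sum_eq_sum_diag_of_symm {ι R : Type*} [Fintype ι] [Ring R] [CharP R 2]
    (f : ι → ι → R) (hf : ∀ i j, f i j = f j i) :
    ∑ i, ∑ j, f i j = ∑ i, f i i := by
  classical
  have h : ∑ x : ι × ι, (if x.1 = x.2 then 0 else f x.1 x.2) = 0 := by
    refine Finset.sum_involution (fun x _ => x.swap) ?_ ?_ (by simp) (by simp)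
    · rintro ⟨i, j⟩ -
      by_cases hij : i = j
      · simp [hij]
      · simp [hij, Ne.symm hij, hf j i, CharTwo.add_self_eq_zero]
    · rintro ⟨i, j⟩ - hne heq
      simp_all
  have key : ∀ i j, f i j = (if i = j then f i i else 0) + (if i = j then 0 else f i j) := by
    intro i j
    split_ifs with hij <;> simp [hij]
  rw [Fintype.sum_prod_type] at h
  calc ∑ i, ∑ j, f i j
      = ∑ i, ∑ j, ((if i = j then f i i else 0) + (if i = j then 0 else f i j)) :=
        Finset.sum_congr rfl fun i _ => Finset.sum_congr rfl fun j _ => key i j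
    _ = ∑ i, f i i := by simp [Finset.sum_add_distrib, h]

section ModTwo

variable {ι : Type*} [Fintype ι]

theorem dotProduct_mulVec_self_of_isSymm {S : Matrix ι ι (ZMod 2)} (hS : S.IsSymm)
    (u : ι → ZMod 2) : u ⬝ᵥ S *ᵥ u = u ⬝ᵥ S.diag := by
  simp only [dotProduct, mulVec, Finset.mul_sum]
  rw [sum_sum_eq_sum_diag_of_symm _ fun i j => by rw [hS.apply i j]; ring]
  refine Finset.sum_congr rfl fun i _ => ?_
  have h : u i * u i = u i := by generalize u i = t; revert t; decide
  rw [diag_apply, mul_left_comm, h, mul_comm]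

theorem trace_mul_of_isSymm {S T : Matrix ι ι (ZMod 2)} (hS : S.IsSymm) (hT : T.IsSymm) :
    (S * T).trace = S.diag ⬝ᵥ T.diag := by
  simp only [trace, diag_apply, mul_apply, dotProduct]
  exact sum_sum_eq_sum_diag_of_symm _ fun i j => by rw [hS.apply i j, hT.apply i j]

theorem trace_mul_self_zmod_two (X : Matrix ι ι (ZMod 2)) : (X * X).trace = X.trace := by
  simp only [trace, diag_apply, mul_apply]
  rw [sum_sum_eq_sum_diag_of_symm _ fun i j => mul_comm _ _]
  refine Finset.sum_congr rfl fun i _ => ?_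
  generalize X i i = t; revert t; decide

/-- The dot product of the two halves of a characteristic is invariant under the affine action of
a symplectic matrix modulo two. -/
theorem dotProduct_affine_symplectic [DecidableEq ι] {A B C D : Matrix ι ι (ZMod 2)}
    (hAB : (A * Bᵀ).IsSymm) (hCD : (C * Dᵀ).IsSymm) (hAC : (Aᵀ * C).IsSymm)
    (hBD : (Bᵀ * D).IsSymm) (hDA : Dᵀ * A = 1 + Bᵀ * C) (x y : ι → ZMod 2) :
    (D *ᵥ x + C *ᵥ y + (C * Dᵀ).diag) ⬝ᵥ (B *ᵥ x + A *ᵥ y + (A * Bᵀ).diag) = x ⬝ᵥ y := by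
  have two : ∀ t : ZMod 2, t + t = 0 := CharTwo.add_self_eq_zero
  have hAC' : Cᵀ * A = Aᵀ * C := by simpa using hAC.eq
  have hBD' : Dᵀ * B = Bᵀ * D := by simpa using hBD.eq
  have hAD : Aᵀ * D = 1 + Cᵀ * B := by simpa using congrArg transpose hDA
  have matTwo : ∀ M : Matrix ι ι (ZMod 2), M + M = 0 := fun M => by ext; exact two _
  have constant : (C * Dᵀ).diag ⬝ᵥ (A * Bᵀ).diag = 0 := by
    rw [← trace_mul_of_isSymm hCD hAB]
    have : C * Dᵀ * (A * Bᵀ) = C * Bᵀ + C * Bᵀ * (C * Bᵀ) := by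
      calc C * Dᵀ * (A * Bᵀ) = C * (Dᵀ * A) * Bᵀ := by simp only [Matrix.mul_assoc]
        _ = _ := by rw [hDA]; simp only [Matrix.mul_add, Matrix.add_mul, Matrix.mul_assoc,
                      Matrix.mul_one]
    rw [this, trace_add, trace_mul_self_zmod_two, two]
  have pull : ∀ (M N P : Matrix ι ι (ZMod 2)) (v w : ι → ZMod 2),
      (M *ᵥ v) ⬝ᵥ P *ᵥ (N *ᵥ w) = v ⬝ᵥ (Mᵀ * P * N) *ᵥ w := by
    intro M N P v w
    rw [← vecMul_transpose, ← dotProduct_mulVec]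
    simp only [mulVec_mulVec, Matrix.mul_assoc]
  have pull' : ∀ (M N : Matrix ι ι (ZMod 2)) (v w : ι → ZMod 2),
      (M *ᵥ v) ⬝ᵥ (N *ᵥ w) = v ⬝ᵥ (Mᵀ * N) *ᵥ w := by
    intro M N v w
    rw [← vecMul_transpose, ← dotProduct_mulVec, mulVec_mulVec]
  have linear_x : (D *ᵥ x) ⬝ᵥ (A * Bᵀ).diag + (B *ᵥ x) ⬝ᵥ (C * Dᵀ).diag
      = (D *ᵥ x) ⬝ᵥ (B *ᵥ x) := by
    rw [← dotProduct_mulVec_self_of_isSymm hAB, ← dotProduct_mulVec_self_of_isSymm hCD,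
      pull, pull, pull', ← dotProduct_add, ← add_mulVec]
    congr 2
    calc Dᵀ * (A * Bᵀ) * D + Bᵀ * (C * Dᵀ) * B
        = Dᵀ * A * (Bᵀ * D) + Bᵀ * C * (Dᵀ * B) := by simp only [Matrix.mul_assoc]
      _ = Dᵀ * B := by
        rw [hDA, hBD', Matrix.add_mul, Matrix.one_mul, add_assoc, matTwo, add_zero]
  have linear_y : (C *ᵥ y) ⬝ᵥ (A * Bᵀ).diag + (A *ᵥ y) ⬝ᵥ (C * Dᵀ).diag
      = (C *ᵥ y) ⬝ᵥ (A *ᵥ y) := by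
    rw [← dotProduct_mulVec_self_of_isSymm hAB, ← dotProduct_mulVec_self_of_isSymm hCD,
      pull, pull, pull', ← dotProduct_add, ← add_mulVec]
    congr 2
    calc Cᵀ * (A * Bᵀ) * C + Aᵀ * (C * Dᵀ) * A
        = Cᵀ * A * (Bᵀ * C) + Aᵀ * C * (Dᵀ * A) := by simp only [Matrix.mul_assoc]
      _ = Cᵀ * A := by
        rw [hDA, hAC', Matrix.mul_add, Matrix.mul_one, add_left_comm, matTwo, add_zero]
  have cross : (D *ᵥ x) ⬝ᵥ (A *ᵥ y) + (B *ᵥ x) ⬝ᵥ (C *ᵥ y) = x ⬝ᵥ y := by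
    rw [pull', pull', hDA, ← dotProduct_add, ← add_mulVec, add_assoc, matTwo, add_zero,
      one_mulVec]
  simp only [add_dotProduct, dotProduct_add]
  rw [dotProduct_comm (C *ᵥ y) (B *ᵥ x), dotProduct_comm (C * Dᵀ).diag (B *ᵥ x),
    dotProduct_comm (C * Dᵀ).diag (A *ᵥ y), constant]
  linear_combination cross + linear_x + linear_y + two ((D *ᵥ x) ⬝ᵥ (B *ᵥ x)) +
    two ((C *ᵥ y) ⬝ᵥ (A *ᵥ y))

end ModTwo

theorem isSymplectic_iff_mem_symplecticGroup {g : ℕ} {R : Type*} [CommRing R]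
    {a b c d : Matrix (Fin g) (Fin g) R} :
    IsSymplectic a b c d ↔ fromBlocks a b c d ∈ symplecticGroup (Fin g) R := by
  have hJ : Jmat g R = -J (Fin g) R := by simp [Jmat, J, fromBlocks_neg]
  rw [SymplecticGroup.mem_iff', IsSymplectic, hJ, Matrix.mul_neg, Matrix.neg_mul, neg_inj]

theorem charAction_eq_affine {g : ℕ} (a b c d : Matrix (Fin g) (Fin g) ℤ) (m : ThetaChar g) :
    charAction a b c d m =
      let A := a.map (Int.castRingHom (ZMod 2))
      let B := b.map (Int.castRingHom (ZMod 2))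
      let C := c.map (Int.castRingHom (ZMod 2))
      let D := d.map (Int.castRingHom (ZMod 2))
      (D *ᵥ m.1 + C *ᵥ m.2 + (C * Dᵀ).diag, B *ᵥ m.1 + A *ᵥ m.2 + (A * Bᵀ).diag) := by
  ext i <;>
    simp [charAction, mulVec, dotProduct, mul_apply, sub_eq_add_neg, CharTwo.neg_eq]

theorem IsSymplectic.dotProduct_charAction {g : ℕ} {a b c d : Matrix (Fin g) (Fin g) ℤ}
    (h : IsSymplectic a b c d) (m : ThetaChar g) :
    (charAction a b c d m).1 ⬝ᵥ (charAction a b c d m).2 = m.1 ⬝ᵥ m.2 := by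
  have hmem := SymplecticGroup.map_mem
    (isSymplectic_iff_mem_symplecticGroup.1 h) (Int.castRingHom (ZMod 2))
  have hmem' := SymplecticGroup.transpose_mem hmem
  rw [fromBlocks_map] at hmem hmem'
  rw [fromBlocks_transpose] at hmem'
  rw [SymplecticGroup.fromBlocks_mem_iff] at hmem hmem'
  set A := a.map (Int.castRingHom (ZMod 2))
  set B := b.map (Int.castRingHom (ZMod 2))
  set C := c.map (Int.castRingHom (ZMod 2))
  set D := d.map (Int.castRingHom (ZMod 2))
  obtain ⟨hAC, hBD, hAD⟩ := hmem
  obtain ⟨hAB, hCD, -⟩ := hmem'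
  simp only [transpose_transpose] at hAB hCD
  have hDA : Dᵀ * A = 1 + Bᵀ * C := by
    simpa [sub_eq_iff_eq_add] using congrArg transpose hAD
  rw [charAction_eq_affine]
  exact dotProduct_affine_symplectic (by simp [IsSymm, hAB]) (by simp [IsSymm, hCD])
    (by simp [IsSymm, hAC]) (by simp [IsSymm, hBD]) hDA m.1 m.2

theorem charParity_eq_iff {g : ℕ} {m m' : ThetaChar g} :
    charParity m = charParity m' ↔ m.1 ⬝ᵥ m.2 = m'.1 ⬝ᵥ m'.2 := by
  have h : ∀ n : ThetaChar g, ((charDot n : ℕ) : ZMod 2) = n.1 ⬝ᵥ n.2 := fun n => by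
    simp [charDot, dotProduct]
  rw [← h, ← h, ZMod.natCast_eq_natCast_iff', charParity, charParity]
  rcases Nat.mod_two_eq_zero_or_one (charDot m) with h₁ | h₁ <;>
  rcases Nat.mod_two_eq_zero_or_one (charDot m') with h₂ | h₂ <;>
  simp [neg_one_pow_eq_pow_mod_two (charDot m), neg_one_pow_eq_pow_mod_two (charDot m'), h₁, h₂]

/-- The symplectic transvection along an integral vector `(p, q)`. -/
theorem isSymplectic_transvection {g : ℕ} (p q : Fin g → ℤ) :
    IsSymplectic (1 - vecMulVec p q) (vecMulVec p p) (-vecMulVec q q) (1 + vecMulVec q p) := by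
  rw [isSymplectic_iff_mem_symplecticGroup, SymplecticGroup.fromBlocks_mem_iff]
  simp only [transpose_sub, transpose_add, transpose_neg, transpose_one, transpose_vecMulVec,
    Matrix.sub_mul, Matrix.mul_add, Matrix.add_mul, Matrix.mul_sub, Matrix.mul_neg,
    Matrix.neg_mul, Matrix.one_mul, Matrix.mul_one, vecMulVec_mul_vecMulVec, vecMulVec_smul,
    dotProduct_comm q p]
  exact ⟨by module, trivial, by module⟩

theorem charAction_transvection {g : ℕ} (p q : Fin g → ℤ) (m : ThetaChar g)
    (h : (fun i => (p i : ZMod 2)) ⬝ᵥ m.1 + (fun i => (q i : ZMod 2)) ⬝ᵥ m.2 +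
      (fun i => (p i : ZMod 2)) ⬝ᵥ (fun i => (q i : ZMod 2)) = 0) :
    charAction (1 - vecMulVec p q) (vecMulVec p p) (-vecMulVec q q) (1 + vecMulVec q p) m =
      (m.1 + fun i => (q i : ZMod 2), m.2 + fun i => (p i : ZMod 2)) := by
  rw [charAction_eq_affine]
  set P : Fin g → ZMod 2 := fun i => p i
  set Q : Fin g → ZMod 2 := fun i => q i
  have map_vec : ∀ u v : Fin g → ℤ, (vecMulVec u v).map (Int.castRingHom (ZMod 2)) =
      vecMulVec (fun i => (u i : ZMod 2)) (fun i => (v i : ZMod 2)) := fun u v => by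
    ext; simp [vecMulVec_apply]
  have neg : ∀ M : Matrix (Fin g) (Fin g) (ZMod 2), -M = M := fun M => by
    ext; exact CharTwo.neg_eq _
  have ha : (1 - vecMulVec p q).map (Int.castRingHom (ZMod 2)) = 1 + vecMulVec P Q := by
    rw [Matrix.map_sub _ (by simp), map_vec, Matrix.map_one _ (by simp) (by simp),
      sub_eq_add_neg, neg]
  have hb : (vecMulVec p p).map (Int.castRingHom (ZMod 2)) = vecMulVec P P := map_vec p p
  have hc : (-vecMulVec q q).map (Int.castRingHom (ZMod 2)) = vecMulVec Q Q := by
    rw [Matrix.map_neg _ (by simp), map_vec, neg]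
  have hd : (1 + vecMulVec q p).map (Int.castRingHom (ZMod 2)) = 1 + vecMulVec Q P := by
    rw [Matrix.map_add _ (by simp), map_vec, Matrix.map_one _ (by simp) (by simp)]
  have sq : ∀ t : ZMod 2, t * t = t := by decide
  rw [ha, hb, hc, hd]
  refine Prod.ext ?_ ?_ <;> funext i
  · simp [add_mulVec, vecMulVec_mulVec, Matrix.mul_add, vecMulVec_mul_vecMulVec,
      dotProduct_comm Q P]
    linear_combination Q i * h + (1 + P ⬝ᵥ Q) * sq (Q i)
  · simp [add_mulVec, vecMulVec_mulVec, Matrix.add_mul, vecMulVec_mul_vecMulVec,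
      dotProduct_comm Q P]
    linear_combination P i * h + (1 + P ⬝ᵥ Q) * sq (P i)

/-- The action of `Sp(2g, ℤ)` on characteristics preserves parity, and the even
and odd characteristics each form a single orbit. -/
theorem charAction_parity_and_orbits (g : ℕ) :
    (∀ a b c d : Matrix (Fin g) (Fin g) ℤ, IsSymplectic a b c d →
      ∀ m : ThetaChar g, charParity (charAction a b c d m) = charParity m) ∧
    (∀ m m' : ThetaChar g, charParity m = charParity m' →
      ∃ a b c d : Matrix (Fin g) (Fin g) ℤ,
        IsSymplectic a b c d ∧ charAction a b c d m = m') := by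
  refine ⟨fun a b c d h m => charParity_eq_iff.2 (h.dotProduct_charAction m), fun m m' h => ?_⟩
  rw [charParity_eq_iff] at h
  refine ⟨_, _, _, _, isSymplectic_transvection (fun i => ((m.2 i + m'.2 i).val : ℤ))
    (fun i => ((m.1 i + m'.1 i).val : ℤ)), ?_⟩
  have two : ∀ t : ZMod 2, t + t = 0 := CharTwo.add_self_eq_zero
  have cast_val : ∀ t : ZMod 2, (((t.val : ℕ) : ℤ) : ZMod 2) = t := by decide
  rw [charAction_transvection]
  · ext i <;> simp only [cast_val, Pi.add_apply, ← add_assoc, two, zero_add]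
  · simp only [cast_val]
    change (m.2 + m'.2) ⬝ᵥ m.1 + (m.1 + m'.1) ⬝ᵥ m.2 + (m.2 + m'.2) ⬝ᵥ (m.1 + m'.1) = 0
    simp only [add_dotProduct, dotProduct_add]
    rw [dotProduct_comm m.2 m.1, dotProduct_comm m'.2 m.1, dotProduct_comm m.2 m'.1,
      dotProduct_comm m'.2 m'.1]
    linear_combination h + two (m.1 ⬝ᵥ m.2) + two (m.1 ⬝ᵥ m'.2) +
      two (m'.1 ⬝ᵥ m.2) + two (m'.1 ⬝ᵥ m'.2)
end

section
/- Let (n_1, …, n_7) be an Aronhold set of odd characteristics in genus 3 and let m := n_1 + ⋯ + n_7 (mod 2). Then the 21 characteristics n_{ij} := m + n_i + n_j (mod 2) for 1 ≤ i < j ≤ 7 are all odd, pairwise distinct, and distinct from n_1, …, n_7; together with n_1, …, n_7 they exhaust all 28 odd characteristics of (ℤ/2)³ × (ℤ/2)³. -/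
open scoped BigOperators
open Complex Matrix

/-- The quadratic form `m ↦ m'·m''` on characteristics, with values in `ZMod 2`. -/
def charQuad {g : ℕ} (m : ThetaChar g) : ZMod 2 := ∑ i, m.1 i * m.2 i

theorem natCast_charDot {g : ℕ} (m : ThetaChar g) : (charDot m : ZMod 2) = charQuad m := by
  simp [charDot, charQuad]

theorem isEvenChar_iff {g : ℕ} (m : ThetaChar g) : IsEvenChar m ↔ charQuad m = 0 := by
  rw [IsEvenChar, charParity, neg_one_pow_eq_one_iff_even (by norm_num), ← natCast_charDot,
    ZMod.natCast_eq_zero_iff_even]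

theorem isOddChar_iff {g : ℕ} (m : ThetaChar g) : IsOddChar m ↔ charQuad m = 1 := by
  rw [IsOddChar, charParity, neg_one_pow_eq_neg_one_iff_odd (by norm_num), ← natCast_charDot,
    ZMod.natCast_eq_one_iff_odd]

theorem IsOddChar.not_isEvenChar {g : ℕ} {m : ThetaChar g} (h : IsOddChar m) :
    ¬ IsEvenChar m := by
  rw [isEvenChar_iff, (isOddChar_iff m).1 h]
  exact one_ne_zero

theorem card_charQuad_eq_one : Fintype.card {x : ThetaChar 3 // charQuad x = 1} = 28 := by
  decide +kernel

/-- Expansion of the quadratic form on a sum of seven characteristics along the lines of the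
Fano plane. -/
theorem charQuad_sum_seven {g : ℕ} (n : Fin 7 → ThetaChar g) :
    charQuad (∑ i, n i) =
      charQuad (n 0 + n 1 + n 2) + charQuad (n 0 + n 3 + n 4) + charQuad (n 0 + n 5 + n 6) +
      charQuad (n 1 + n 3 + n 5) + charQuad (n 1 + n 4 + n 6) + charQuad (n 2 + n 3 + n 6) +
      charQuad (n 2 + n 4 + n 5) - 2 * ∑ i, charQuad (n i) := by
  simp only [charQuad, Fin.sum_univ_seven, Finset.mul_sum, ← Finset.sum_add_distrib,
    ← Finset.sum_sub_distrib, Prod.fst_add, Prod.snd_add, Pi.add_apply]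
  exact Finset.sum_congr rfl fun i _ => by ring

/-- A property of unordered triples of distinct indices holds as soon as it holds for
increasing triples. -/
theorem forall_distinct_triple {α M : Type*} [LinearOrder α] [AddCommMonoid M] (f : α → M)
    (P : M → Prop) (h : ∀ i j k, i < j → j < k → P (f i + f j + f k)) (i j k : α)
    (hij : i ≠ j) (hik : i ≠ k) (hjk : j ≠ k) : P (f i + f j + f k) := by
  rcases hij.lt_or_gt with h1 | h1 <;> rcases hik.lt_or_gt with h2 | h2 <;>
    rcases hjk.lt_or_gt with h3 | h3
  · exact h _ _ _ h1 h3
  · simpa only [add_right_comm] using h _ _ _ h2 h3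
  · exact absurd (h1.trans h3) h2.asymm
  · simpa only [add_comm, add_left_comm] using h _ _ _ h2 h1
  · simpa only [add_comm, add_left_comm] using h _ _ _ h1 h2
  · exact absurd (h2.trans h3) h1.asymm
  · simpa only [add_comm, add_left_comm] using h _ _ _ h3 h2
  · simpa only [add_comm, add_left_comm] using h _ _ _ h3 h1

namespace IsAronhold

variable {n : Fin 7 → ThetaChar 3}

theorem isEvenChar_add_add (hA : IsAronhold n) {i j k : Fin 7} (hij : i ≠ j) (hik : i ≠ k)
    (hjk : j ≠ k) : IsEvenChar (n i + n j + n k) := by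
  refine forall_distinct_triple n IsEvenChar (fun i j k hij hjk => ?_) i j k hij hik hjk
  have h := hA.2.2 i.castSucc j.castSucc k.castSucc hij hjk
  have hi : charParity (n i) = -1 := hA.2.1 i
  have hj : charParity (n j) = -1 := hA.2.1 j
  have hk : charParity (n k) = -1 := hA.2.1 k
  simpa [Fin.snoc_castSucc, hi, hj, hk, IsEvenChar] using h

theorem isEvenChar_sum (hA : IsAronhold n) : IsEvenChar (∑ i, n i) := by
  have h (i j k : Fin 7) (hij : i ≠ j) (hik : i ≠ k) (hjk : j ≠ k) :
      charQuad (n i + n j + n k) = 0 :=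
    (isEvenChar_iff _).1 (hA.isEvenChar_add_add hij hik hjk)
  rw [isEvenChar_iff, charQuad_sum_seven, h 0 1 2, h 0 3 4, h 0 5 6, h 1 3 5, h 1 4 6, h 2 3 6,
    h 2 4 5, CharTwo.two_eq_zero (R := ZMod 2)] <;> simp

theorem isOddChar_sum_add_add (hA : IsAronhold n) {i j : Fin 7} (hij : i ≠ j) :
    IsOddChar (∑ l, n l + n i + n j) := by
  wlog hlt : i < j generalizing i j
  · rw [add_right_comm]
    exact this hij.symm (lt_of_le_of_ne (not_lt.1 hlt) hij.symm)
  have h := hA.2.2 i.castSucc j.castSucc (Fin.last 7) hlt (Fin.castSucc_lt_last j)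
  have hi : charParity (n i) = -1 := hA.2.1 i
  have hj : charParity (n j) = -1 := hA.2.1 j
  have hs : charParity (∑ l, n l) = 1 := hA.isEvenChar_sum
  rw [Fin.snoc_castSucc, Fin.snoc_castSucc, Fin.snoc_last, hi, hj, hs] at h
  rw [IsOddChar, add_assoc, add_comm]
  simpa using h

theorem sum_add_add_ne (hA : IsAronhold n) (i j k : Fin 7) :
    ∑ l, n l + n i + n j ≠ n k := by
  intro h
  have hsum : ∑ l, n l = n i + n j + n k := by
    rw [← h]
    linear_combination -(n i + n j) * CharTwo.two_eq_zero (R := ThetaChar 3)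
  have hik : i ≠ k := by
    rintro rfl
    refine (hA.2.1 j).not_isEvenChar ?_
    convert hA.isEvenChar_sum using 1
    linear_combination -hsum - n i * CharTwo.two_eq_zero (R := ThetaChar 3)
  have hjk : j ≠ k := by
    rintro rfl
    refine (hA.2.1 i).not_isEvenChar ?_
    convert hA.isEvenChar_sum using 1
    linear_combination -hsum - n j * CharTwo.two_eq_zero (R := ThetaChar 3)
  obtain ⟨l, hl⟩ : ∃ l, l ∉ ({i, j, k} : Finset (Fin 7)) := by
    by_contra! hall
    have hcard := Finset.card_le_card fun l (_ : l ∈ Finset.univ) => hall l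
    exact absurd (hcard.trans Finset.card_le_three) (by decide)
  simp only [Finset.mem_insert, Finset.mem_singleton, not_or] at hl
  obtain ⟨hli, hlj, hlk⟩ := hl
  refine (hA.isOddChar_sum_add_add (Ne.symm hli)).not_isEvenChar ?_
  convert hA.isEvenChar_add_add hjk (Ne.symm hlj) (Ne.symm hlk) using 1
  linear_combination hsum + n i * CharTwo.two_eq_zero (R := ThetaChar 3)

theorem sum_add_add_inj (hA : IsAronhold n) {i j k l : Fin 7} (hij : i < j) (hkl : k < l)
    (h : ∑ l, n l + n i + n j = ∑ l, n l + n k + n l) : i = k ∧ j = l := by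
  have h' : n i + n j = n k + n l := by
    linear_combination h
  by_cases hik : i = k
  · subst hik
    exact ⟨rfl, hA.1 (add_left_cancel h')⟩
  by_cases hjk : j = k
  · subst hjk
    have : i = l := hA.1 (by linear_combination h')
    omega
  refine absurd ?_ (hA.2.1 l).not_isEvenChar
  convert hA.isEvenChar_add_add hij.ne hik hjk using 1
  linear_combination -h' - n k * CharTwo.two_eq_zero (R := ThetaChar 3)

end IsAronhold

/-- Given an Aronhold set `n₁, …, n₇` with sum `m`, the 21 characteristics
`n_{ij} = m + nᵢ + nⱼ` (for `i < j`) are odd, pairwise distinct and distinct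
from `n₁, …, n₇`; together with the `nᵢ` they exhaust the 28 odd
characteristics. -/
theorem aronhold_completes_odd_chars (n : Fin 7 → ThetaChar 3) (hA : IsAronhold n)
    (m : ThetaChar 3) (hm : m = ∑ i, n i) :
    (∀ i j : Fin 7, i < j → IsOddChar (m + n i + n j)) ∧
    (∀ i j k l : Fin 7, i < j → k < l →
      m + n i + n j = m + n k + n l → i = k ∧ j = l) ∧
    (∀ i j k : Fin 7, i < j → m + n i + n j ≠ n k) ∧
    (∀ x : ThetaChar 3, IsOddChar x →
      (∃ k, x = n k) ∨ ∃ i j : Fin 7, i < j ∧ x = m + n i + n j) := by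
  subst hm
  have odd (i j : Fin 7) (hij : i < j) := hA.isOddChar_sum_add_add hij.ne
  have inj (i j k l : Fin 7) (hij : i < j) (hkl : k < l) := hA.sum_add_add_inj hij hkl
  refine ⟨odd, inj, fun i j k _ => hA.sum_add_add_ne i j k, fun x hx => ?_⟩
  let f : Fin 7 ⊕ {p : Fin 7 × Fin 7 // p.1 < p.2} → {x : ThetaChar 3 // charQuad x = 1} :=
    Sum.elim (fun k => ⟨n k, (isOddChar_iff _).1 (hA.2.1 k)⟩)
      fun p => ⟨∑ l, n l + n p.1.1 + n p.1.2, (isOddChar_iff _).1 (odd _ _ p.2)⟩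
  have hf : Function.Injective f := by
    refine Function.Injective.sumElim (fun a b hab => hA.1 (congrArg Subtype.val hab))
      (fun a b hab => ?_) fun a b hab => hA.sum_add_add_ne _ _ _ (congrArg Subtype.val hab).symm
    obtain ⟨h1, h2⟩ := inj _ _ _ _ a.2 b.2 (congrArg Subtype.val hab)
    exact Subtype.ext (Prod.ext h1 h2)
  have hcard : Fintype.card (Fin 7 ⊕ {p : Fin 7 × Fin 7 // p.1 < p.2}) =
      Fintype.card {x : ThetaChar 3 // charQuad x = 1} := by
    rw [card_charQuad_eq_one]
    decide +kernel
  obtain ⟨k | p, hp⟩ :=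
    ((Fintype.bijective_iff_injective_and_card f).2 ⟨hf, hcard⟩).2 ⟨x, (isOddChar_iff x).1 hx⟩
  · exact Or.inl ⟨k, (congrArg Subtype.val hp).symm⟩
  · exact Or.inr ⟨p.1.1, p.1.2, p.2, (congrArg Subtype.val hp).symm⟩
end
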